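/- arXiv:1511.04248 — 4 statements merged into one kernel-verified Lean document; each statement's English description precedes it below -/
import Mathlib

section
/- For every τ with Im τ > 0, the theta-constants satisfy the τ-duplication formulas: θ00(0, 2τ)² = (θ00(0,τ)² + θ01(0,τ)²)/2 and θ01(0, 2τ)² = θ00(0,τ)·θ01(0,τ). -/
open Complex Real

noncomputable def θ00 (z τ : ℂ) : ℂ := jacobiTheta₂ z τ

noncomputable def θ01 (z τ : ℂ) : ℂ := jacobiTheta₂ (z + 1/2) τ

lemma aux_congr {f g : ℤ × ℤ → ℂ} {a : ℂ} (h : HasSum f a) (e : ∀ p, g p = f p) : HasSum g a := by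
  rwa [funext e]

lemma aux_half (n : ℤ) (τ : ℂ) :
    jacobiTheta₂_term n (0 + 1/2) τ = (-1 : ℂ) ^ n * jacobiTheta₂_term n 0 τ := by
  rw [jacobiTheta₂_term, jacobiTheta₂_term, ← Complex.exp_pi_mul_I, ← Complex.exp_int_mul,
    ← Complex.exp_add]
  congr 1
  ring

lemma aux_dup (m n : ℤ) (τ : ℂ) :
    jacobiTheta₂_term (m + n) 0 τ * jacobiTheta₂_term (m - n) 0 τ =
      jacobiTheta₂_term m 0 (2 * τ) * jacobiTheta₂_term n 0 (2 * τ) := by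
  simp only [jacobiTheta₂_term]
  rw [← Complex.exp_add, ← Complex.exp_add]
  congr 1
  push_cast
  ring

lemma aux_mul {f g : ℤ → ℂ} {a b : ℂ} (hf : HasSum f a) (hg : HasSum g b) :
    HasSum (fun p : ℤ × ℤ => f p.1 * g p.2) (a * b) := by
  have h3 : Summable (fun p : ℤ × ℤ => f p.1 * g p.2) :=
    summable_mul_of_summable_norm hf.summable.norm hg.summable.norm
  rw [← hf.tsum_eq, ← hg.tsum_eq,
    tsum_mul_tsum_of_summable_norm hf.summable.norm hg.summable.norm]
  exact h3.hasSum

lemma aux_prod (z w τ : ℂ) (hτ : 0 < τ.im) :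
    HasSum (fun p : ℤ × ℤ => jacobiTheta₂_term p.1 z τ * jacobiTheta₂_term p.2 w τ)
      (jacobiTheta₂ z τ * jacobiTheta₂ w τ) := by
  have h1 : HasSum (fun n : ℤ => jacobiTheta₂_term n z τ) (jacobiTheta₂ z τ) :=
    hasSum_jacobiTheta₂_term z hτ
  have h2 : HasSum (fun n : ℤ => jacobiTheta₂_term n w τ) (jacobiTheta₂ w τ) :=
    hasSum_jacobiTheta₂_term w hτ
  have h3 := aux_mul h1 h2
  exact h3

lemma aux_inj : Function.Injective (fun p : ℤ × ℤ => (p.1 + p.2, p.1 - p.2)) := by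
  rintro ⟨a, b⟩ ⟨c, d⟩ h
  simp only [Prod.mk.injEq] at h ⊢
  omega

lemma aux_odd {p : ℤ × ℤ} (hp : p ∉ Set.range (fun p : ℤ × ℤ => (p.1 + p.2, p.1 - p.2))) :
    (-1 : ℂ) ^ p.1 = - (-1 : ℂ) ^ p.2 := by
  obtain ⟨a, b⟩ := p
  have h : Odd (a + b) := by
    by_contra h
    rw [Int.not_odd_iff_even] at h
    obtain ⟨k, hk⟩ := h
    exact hp ⟨(k, a - k), by simp only [Prod.mk.injEq]; omega⟩
  rcases Int.even_or_odd a with ha | ha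
  · have hb : Odd b := by grind
    simp [ha.neg_one_zpow, hb.neg_one_zpow]
  · have hb : Even b := by grind
    simp [ha.neg_one_zpow, hb.neg_one_zpow]

lemma aux_sq (n : ℤ) : (-1 : ℂ) ^ n * (-1 : ℂ) ^ n = 1 := by
  rw [← mul_zpow]; simp

lemma aux_add (m n : ℤ) : (-1 : ℂ) ^ (m + n) = (-1 : ℂ) ^ m * (-1 : ℂ) ^ n :=
  zpow_add₀ (by norm_num) m n

lemma aux_sub (m n : ℤ) : (-1 : ℂ) ^ (m - n) = (-1 : ℂ) ^ m * (-1 : ℂ) ^ n := by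
  rcases Int.even_or_odd n with h | h <;>
  rw [zpow_sub₀ (by norm_num), h.neg_one_zpow] <;> ring

theorem thetaConstants_tau_duplication (τ : ℂ) (hτ : 0 < τ.im) :
    θ00 0 (2 * τ) ^ 2 = (θ00 0 τ ^ 2 + θ01 0 τ ^ 2) / 2 ∧
    θ01 0 (2 * τ) ^ 2 = θ00 0 τ * θ01 0 τ := by
  have hτ2 : 0 < (2 * τ).im := by simpa using hτ
  simp only [θ00, θ01, sq]
  constructor
  · have h := ((aux_prod (0) (0) τ hτ).add
      (aux_prod (0 + 1/2) (0 + 1/2) τ hτ)).div_const 2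
    rw [← aux_inj.hasSum_iff] at h
    · refine (aux_prod _ _ _ hτ2).unique (aux_congr h ?_)
      rintro ⟨m, n⟩
      simp only [Function.comp, aux_half, ← aux_dup, aux_add, aux_sub]
      linear_combination (-1/2) * (jacobiTheta₂_term (m + n) 0 τ * jacobiTheta₂_term (m - n) 0 τ) *
        ((-1 : ℂ) ^ n * (-1 : ℂ) ^ n * aux_sq m + aux_sq n)
    · intro p hp
      simp only [aux_half, aux_odd hp]
      linear_combination (-1/2) * (jacobiTheta₂_term p.1 0 τ * jacobiTheta₂_term p.2 0 τ) *
        aux_sq p.2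
  · have h := ((aux_prod (0) (0 + 1/2) τ hτ).add
      (aux_prod (0 + 1/2) (0) τ hτ)).div_const 2
    rw [← aux_inj.hasSum_iff] at h
    · have := (aux_prod _ _ _ hτ2).unique (aux_congr h (g := fun p : ℤ × ℤ =>
        jacobiTheta₂_term p.1 (0 + 1/2) (2 * τ) * jacobiTheta₂_term p.2 (0 + 1/2) (2 * τ)) ?_)
      · rw [this]; ring
      rintro ⟨m, n⟩
      simp only [Function.comp, aux_half, aux_add, aux_sub]
      linear_combination (-1 : ℂ) ^ m * (-1 : ℂ) ^ n * (-aux_dup m n τ)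
    · intro p hp
      simp only [aux_half, aux_odd hp]
      ring
end

section
/- For every z ∈ ℂ and τ with Im τ > 0: θ00(z, 2τ)² = (θ00(z,τ)·θ00(0,τ) + θ01(z,τ)·θ01(0,τ))/2 and θ01(z, 2τ)² = (θ00(z,τ)·θ01(0,τ) + θ01(z,τ)·θ00(0,τ))/2. -/
open Complex Real

lemma term_half (n : ℤ) (z τ : ℂ) :
    jacobiTheta₂_term n (z + 1/2) τ = (-1 : ℂ) ^ n * jacobiTheta₂_term n z τ := by
  unfold jacobiTheta₂_term
  rw [← Complex.exp_pi_mul_I, ← Complex.exp_int_mul, ← Complex.exp_add]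
  congr 1
  ring

lemma hasSum_mul_aux (f g : ℤ → ℂ) (a b : ℂ) (h1 : HasSum f a) (h2 : HasSum g b) :
    HasSum (fun p : ℤ × ℤ => f p.1 * g p.2) (a * b) := by
  have n1 : Summable (fun n : ℤ => ‖f n‖) := h1.summable.norm
  have n2 : Summable (fun n : ℤ => ‖g n‖) := h2.summable.norm
  exact HasSum.mul h1 h2 (summable_mul_of_summable_norm n1 n2)

lemma hasSum_mul_term (z w : ℂ) {τ : ℂ} (hτ : 0 < τ.im) :
    HasSum (fun p : ℤ × ℤ => jacobiTheta₂_term p.1 z τ * jacobiTheta₂_term p.2 w τ)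
      (jacobiTheta₂ z τ * jacobiTheta₂ w τ) :=
  hasSum_mul_aux (fun n => jacobiTheta₂_term n z τ) (fun n => jacobiTheta₂_term n w τ) _ _
    (hasSum_jacobiTheta₂_term z hτ) (hasSum_jacobiTheta₂_term w hτ)

lemma theta_dup_aux (z τ : ℂ) (hτ : 0 < τ.im) :
    jacobiTheta₂ z (2 * τ) ^ 2 = (jacobiTheta₂ z τ * jacobiTheta₂ 0 τ
      + jacobiTheta₂ (z + 1/2) τ * jacobiTheta₂ (0 + 1/2) τ) / 2 := by
  have hτ2 : 0 < (2 * τ).im := by simpa using hτ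
  have hR := ((hasSum_mul_term z 0 hτ).add (hasSum_mul_term (z + 1/2) (0 + 1/2) hτ)).div_const 2
  have hL := hasSum_mul_term z z hτ2
  have hinj : Function.Injective (fun p : ℤ × ℤ => (p.1 + p.2, p.1 - p.2)) := by
    rintro ⟨a, b⟩ ⟨c, d⟩ h
    simp only [Prod.mk.injEq] at h ⊢
    omega
  rw [← hinj.hasSum_iff] at hR
  · rw [sq]
    refine hL.unique ?_
    refine Eq.mp (congrArg (fun f => HasSum f _) ?_) hR
    symm
    funext ⟨a, b⟩
    simp only [Function.comp, term_half]
    have hs : (-1 : ℂ) ^ (a + b) * (-1 : ℂ) ^ (a - b) = 1 := by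
      rw [← zpow_add₀ (by norm_num)]
      exact Even.neg_one_zpow ⟨a, by ring⟩
    have e : jacobiTheta₂_term a z (2 * τ) * jacobiTheta₂_term b z (2 * τ)
        = jacobiTheta₂_term (a + b) z τ * jacobiTheta₂_term (a - b) 0 τ := by
      unfold jacobiTheta₂_term
      rw [← Complex.exp_add, ← Complex.exp_add]
      congr 1
      push_cast
      ring
    rw [e]
    linear_combination (-(jacobiTheta₂_term (a + b) z τ * jacobiTheta₂_term (a - b) 0 τ) / 2) * hs
  · rintro ⟨m, n⟩ h
    have hodd : Odd (m + n) := by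
      rw [← Int.not_even_iff_odd]
      rintro ⟨k, hk⟩
      exact h ⟨(k, m - k), by simp only [Prod.mk.injEq]; omega⟩
    have hs : (-1 : ℂ) ^ m * (-1 : ℂ) ^ n = -1 := by
      rw [← zpow_add₀ (by norm_num)]
      exact hodd.neg_one_zpow
    simp only [term_half]
    linear_combination (jacobiTheta₂_term m z τ * jacobiTheta₂_term n 0 τ / 2) * hs

theorem theta_tau_duplication (z τ : ℂ) (hτ : 0 < τ.im) :
    θ00 z (2 * τ) ^ 2 = (θ00 z τ * θ00 0 τ + θ01 z τ * θ01 0 τ) / 2 ∧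
    θ01 z (2 * τ) ^ 2 = (θ00 z τ * θ01 0 τ + θ01 z τ * θ00 0 τ) / 2 := by
  refine ⟨theta_dup_aux z τ hτ, ?_⟩
  have h := theta_dup_aux (z + 1/2) τ hτ
  have e : z + 1/2 + 1/2 = z + 1 := by ring
  rw [e, jacobiTheta₂_add_left] at h
  unfold θ00 θ01
  rw [h]
  ring
end

section
/- Let τ ∈ ℂ with Im τ > 0 and z ∈ ℂ with 0 ≤ Im z ≤ Im(τ)/2. Then θ(z, 2ⁿτ)^{2ⁿ} → 1 as n → ∞, and consequently θ(z, 2ⁿτ)^{2ⁿ} / θ(0, 2ⁿτ)^{2ⁿ} → 1 as n → ∞. -/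
open Complex Real Filter

lemma theta_sub_one_bound (z τ : ℂ) (hτ : 0 < τ.im) (N : ℕ) (hN : 1 ≤ N) :
    ‖jacobiTheta₂ z ((N : ℂ) * τ) - 1‖ ≤
      (∑' k : ℤ, rexp (-π * (τ.im * k ^ 2 - 2 * |z.im| * |k|))) *
        rexp (-π * ((N - 1) * τ.im)) := by
  have hN' : (1 : ℝ) ≤ N := by exact_mod_cast hN
  have him : ((N : ℂ) * τ).im = N * τ.im := by simp
  have hpos : 0 < ((N : ℂ) * τ).im := by rw [him]; positivity
  have hs := summable_pow_mul_jacobiTheta₂_term_bound |z.im| hτ 0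
  simp only [pow_zero, one_mul] at hs
  have h1 := (hasSum_jacobiTheta₂_term z hpos).sub (hasSum_ite_eq (0 : ℤ) (1 : ℂ))
  rw [← h1.tsum_eq, ← tsum_mul_right]
  refine tsum_of_norm_bounded (hs.mul_right _).hasSum fun k => ?_
  by_cases hk : k = 0
  · subst hk
    simp only [jacobiTheta₂_term]
    simp
    positivity
  · rw [if_neg hk, sub_zero, ← Real.exp_add]
    refine (norm_jacobiTheta₂_term_le hpos le_rfl le_rfl k).trans ?_
    rw [Real.exp_le_exp, him]
    have hk1 : (1 : ℝ) ≤ (k : ℝ) ^ 2 := by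
      have : (1 : ℤ) ≤ k ^ 2 := by have := sq_pos_of_ne_zero hk; omega
      exact_mod_cast this
    have h2 : 0 ≤ π * (((N : ℝ) - 1) * τ.im * ((k : ℝ) ^ 2 - 1)) := by
      have := sub_nonneg.2 hN'
      have := sub_nonneg.2 hk1
      positivity
    push_cast
    linarith

lemma theta_pow_nat (z τ : ℂ) (hτ : 0 < τ.im) :
    Tendsto (fun N : ℕ => jacobiTheta₂ z ((N : ℂ) * τ) ^ N) atTop (nhds 1) := by
  have key : Tendsto (fun N : ℕ => (N : ℂ) * (jacobiTheta₂ z ((N : ℂ) * τ) - 1))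
      atTop (nhds 0) := by
    set C := ∑' k : ℤ, rexp (-π * (τ.im * k ^ 2 - 2 * |z.im| * |k|)) with hC
    have ht : Tendsto (fun N : ℕ => C * rexp (π * τ.im) *
        ((N : ℝ) ^ (1 : ℝ) * rexp (-(π * τ.im) * N))) atTop (nhds 0) := by
      have := (tendsto_rpow_mul_exp_neg_mul_atTop_nhds_zero 1 (π * τ.im)
        (by positivity)).comp tendsto_natCast_atTop_atTop
      simpa using this.const_mul (C * rexp (π * τ.im))
    refine squeeze_zero_norm' ?_ ht
    filter_upwards [eventually_ge_atTop 1] with N hN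
    have hb := theta_sub_one_bound z τ hτ N hN
    rw [← hC] at hb
    rw [norm_mul, Complex.norm_natCast, Real.rpow_one]
    calc _ ≤ (N : ℝ) * (C * rexp (-π * ((N - 1) * τ.im))) := by gcongr
      _ = _ := by
        have : -π * (((N : ℝ) - 1) * τ.im) = π * τ.im + -(π * τ.im) * N := by ring
        rw [this, Real.exp_add]; ring
  have := Complex.tendsto_one_add_pow_exp_of_tendsto key
  simpa using this

theorem theta_pow_two_pow_tendsto_one (z τ : ℂ) (hτ : 0 < τ.im)
    (hz0 : 0 ≤ z.im) (hz1 : z.im ≤ τ.im / 2) :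
    Tendsto (fun n : ℕ => jacobiTheta₂ z ((2 : ℂ) ^ n * τ) ^ (2 ^ n)) atTop (nhds 1) ∧
    Tendsto (fun n : ℕ =>
        jacobiTheta₂ z ((2 : ℂ) ^ n * τ) ^ (2 ^ n) /
          jacobiTheta₂ 0 ((2 : ℂ) ^ n * τ) ^ (2 ^ n)) atTop (nhds 1) := by
  have h : ∀ w : ℂ, Tendsto (fun n : ℕ => jacobiTheta₂ w ((2 : ℂ) ^ n * τ) ^ (2 ^ n))
      atTop (nhds 1) := by
    intro w
    have := (theta_pow_nat w τ hτ).comp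
      (tendsto_pow_atTop_atTop_of_one_lt (r := (2 : ℕ)) (by norm_num))
    refine this.congr fun n => ?_
    simp
  refine ⟨h z, ?_⟩
  have h3 := (h z).div (h 0) one_ne_zero
  rw [div_one] at h3
  exact h3
end

section
/- Let τ ∈ ℂ with Im τ ≥ √3/2 and z ∈ ℂ with 0 ≤ Im z ≤ Im(τ)/4. Then for every n ∈ ℕ: Re(θ00(z, 2ⁿτ)) > 0, Re(θ00(0, 2ⁿτ)) > 0, Re(θ01(z, 2ⁿτ)/θ00(z, 2ⁿτ)) > 0, and Re(θ01(0, 2ⁿτ)/θ00(0, 2ⁿτ)) > 0. (Together with the τ-duplication formulas, this says that the 'optimal F sequence' started at (θ00²(z,τ), θ01²(z,τ), θ00²(0,τ), θ01²(0,τ))—in which all square roots are chosen 'good'—equals (θ00²(z,2ⁿτ), θ01²(z,2ⁿτ), θ00²(0,2ⁿτ), θ01²(0,2ⁿτ)) for all n.) -/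
open Complex Real

lemma exp_aux (y : ℝ) (hy : Real.sqrt 3 / 2 ≤ y) : Real.exp (-(π * y / 2)) ≤ 2 / 7 := by
  have hs : (1.732 : ℝ) ≤ Real.sqrt 3 := Real.le_sqrt_of_sq_le (by norm_num)
  have hp := Real.pi_gt_d2
  have h1 : (1.35 : ℝ) ≤ π * y / 2 := by nlinarith
  have h2 : (7 / 2 : ℝ) ≤ Real.exp (π * y / 2) := by
    have h3 : Real.exp 1.35 ≤ Real.exp (π * y / 2) := Real.exp_le_exp.mpr h1
    have h4 : Real.exp 1.35 = Real.exp 1 * Real.exp 0.35 := by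
      rw [← Real.exp_add]; norm_num
    have h5 := Real.exp_one_gt_d9
    have h6 := Real.add_one_le_exp (0.35 : ℝ)
    nlinarith
  rw [Real.exp_neg]
  calc (Real.exp (π * y / 2))⁻¹ ≤ (7 / 2 : ℝ)⁻¹ := inv_anti₀ (by norm_num) h2
    _ = 2 / 7 := by norm_num

lemma theta_near_one (z τ : ℂ) (hτ : Real.sqrt 3 / 2 ≤ τ.im)
    (hz0 : 0 ≤ z.im) (hz1 : z.im ≤ τ.im / 4) : ‖jacobiTheta₂ z τ - 1‖ ≤ 2 / 5 := by
  have hr := exp_aux τ.im hτ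
  have hτ0 : 0 < τ.im := lt_of_lt_of_le (by positivity) hτ
  obtain ⟨r, hrdef⟩ : ∃ r, r = Real.exp (-(π * τ.im / 2)) := ⟨_, rfl⟩
  have hr0 : 0 < r := hrdef ▸ Real.exp_pos _
  rw [← hrdef] at hr
  have h := (hasSum_jacobiTheta₂_term z hτ0).nat_add_neg
  have h' := (hasSum_nat_add_iff' 1).mpr h
  have e0 : jacobiTheta₂_term 0 z τ = 1 := by simp [jacobiTheta₂_term]
  have hpow : ∀ k : ℕ, r ^ k = Real.exp (-(π * τ.im / 2) * k) := by
    intro k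
    rw [hrdef, ← Real.exp_nat_mul, mul_comm]
  have hb : HasSum (fun n : ℕ => (r ^ 2 + r) * (r ^ 2) ^ n) ((r ^ 2 + r) * (1 - r ^ 2)⁻¹) :=
    (hasSum_geometric_of_lt_one (by positivity) (by nlinarith)).mul_left _
  have hS := h'.tsum_eq
  have key := tsum_of_norm_bounded (f := fun n : ℕ =>
      jacobiTheta₂_term ((n + 1 : ℕ) : ℤ) z τ + jacobiTheta₂_term (-((n + 1 : ℕ) : ℤ)) z τ) hb ?_
  · have e : jacobiTheta₂ z τ - 1 = ∑' n : ℕ, (jacobiTheta₂_term ((n + 1 : ℕ) : ℤ) z τ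
        + jacobiTheta₂_term (-((n + 1 : ℕ) : ℤ)) z τ) := by
      rw [hS]
      simp [e0]
    rw [e]
    refine key.trans ?_
    rw [← div_eq_mul_inv, div_le_iff₀ (by nlinarith)]
    nlinarith
  · intro n
    have hpi := Real.pi_pos
    have hn : (0 : ℝ) ≤ n := Nat.cast_nonneg n
    have hy : 0 < π * τ.im := by positivity
    have hpz : 0 ≤ π * z.im := by positivity
    have hpz1 : π * z.im ≤ π * τ.im / 4 := by nlinarith
    have hnn : 0 ≤ (n : ℝ) * n := by positivity
    have a1 : ‖jacobiTheta₂_term ((n + 1 : ℕ) : ℤ) z τ‖ ≤ r ^ (2 * n + 2) := by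
      rw [norm_jacobiTheta₂_term, hpow]
      apply Real.exp_le_exp.mpr
      push_cast
      nlinarith [mul_nonneg hn hpz, mul_nonneg hn hy.le, mul_nonneg hnn hy.le]
    have a2 : ‖jacobiTheta₂_term (-((n + 1 : ℕ) : ℤ)) z τ‖ ≤ r ^ (2 * n + 1) := by
      rw [norm_jacobiTheta₂_term, hpow]
      apply Real.exp_le_exp.mpr
      push_cast
      nlinarith [mul_nonneg hn (sub_nonneg.mpr hpz1), mul_nonneg hn hy.le, mul_nonneg hnn hy.le]
    calc _ ≤ _ := norm_add_le _ _
      _ ≤ r ^ (2 * n + 2) + r ^ (2 * n + 1) := add_le_add a1 a2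
      _ = _ := by rw [← pow_mul]; ring

lemma re_pos_aux (a : ℂ) (h : ‖a - 1‖ ≤ 2 / 5) : 0 < a.re := by
  have := (abs_le.mp ((Complex.abs_re_le_norm (a - 1)).trans h)).1
  simp at this
  linarith

lemma re_div_pos_aux (a b : ℂ) (ha : ‖a - 1‖ ≤ 2 / 5) (hb : ‖b - 1‖ ≤ 2 / 5) :
    0 < (a / b).re := by
  have hbr := re_pos_aux b hb
  have hb0 : b ≠ 0 := by rintro rfl; simp at hbr
  have hn : 3 / 5 ≤ ‖b‖ := by
    have := norm_sub_norm_le (1 : ℂ) b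
    rw [norm_sub_rev, norm_one] at this
    linarith
  have hab : ‖a - b‖ ≤ 4 / 5 := by
    have := norm_sub_le (a - 1) (b - 1)
    rw [sub_sub_sub_cancel_right] at this
    linarith
  have h1 := (a - 1).sq_norm
  have h2 := (b - 1).sq_norm
  rw [Complex.normSq_apply] at h1 h2
  simp only [Complex.sub_re, Complex.sub_im, Complex.one_re, Complex.one_im] at h1 h2
  have h3 : ‖a - 1‖ ^ 2 ≤ 4 / 25 := by nlinarith [norm_nonneg (a - 1)]
  have h4 : ‖b - 1‖ ^ 2 ≤ 4 / 25 := by nlinarith [norm_nonneg (b - 1)]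
  have hp : 0 < Complex.normSq b := Complex.normSq_pos.mpr hb0
  rw [Complex.div_re, ← add_div]
  apply div_pos _ hp
  have h5 : 3 / 5 ≤ a.re := by
    have := (abs_le.mp ((Complex.abs_re_le_norm (a - 1)).trans ha)).1
    simp at this; linarith
  have h6 : 3 / 5 ≤ b.re := by
    have := (abs_le.mp ((Complex.abs_re_le_norm (b - 1)).trans hb)).1
    simp at this; linarith
  nlinarith [sq_nonneg (a.im + b.im), mul_nonneg (sub_nonneg.mpr h5) (sub_nonneg.mpr h6)]

theorem good_choices_are_thetas (τ z : ℂ) (hτ : Real.sqrt 3 / 2 ≤ τ.im)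
    (hz0 : 0 ≤ z.im) (hz1 : z.im ≤ τ.im / 4) :
    ∀ n : ℕ,
      0 < (θ00 z ((2 : ℂ) ^ n * τ)).re ∧
      0 < (θ00 0 ((2 : ℂ) ^ n * τ)).re ∧
      0 < (θ01 z ((2 : ℂ) ^ n * τ) / θ00 z ((2 : ℂ) ^ n * τ)).re ∧
      0 < (θ01 0 ((2 : ℂ) ^ n * τ) / θ00 0 ((2 : ℂ) ^ n * τ)).re := by
  intro n
  have him : ((2 : ℂ) ^ n * τ).im = 2 ^ n * τ.im := by
    have : ((2 : ℂ) ^ n * τ) = (((2 : ℝ) ^ n : ℝ) : ℂ) * τ := by push_cast; rfl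
    rw [this, Complex.im_ofReal_mul]
  have hτ0 : 0 < τ.im := lt_of_lt_of_le (by positivity) hτ
  have h2 : τ.im ≤ 2 ^ n * τ.im := le_mul_of_one_le_left hτ0.le (one_le_pow₀ (by norm_num))
  have main : ∀ w : ℂ, 0 ≤ w.im → w.im ≤ τ.im / 4 →
      ‖jacobiTheta₂ w ((2 : ℂ) ^ n * τ) - 1‖ ≤ 2 / 5 := fun w h0 h1 =>
    theta_near_one w _ (by rw [him]; linarith) h0 (by rw [him]; linarith)
  have hhalf : ∀ w : ℂ, (w + 1 / 2).im = w.im := by intro w; simp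
  have m1 := main z hz0 hz1
  have m2 := main 0 (by simp) (by simp; linarith)
  have m3 := main (z + 1 / 2) (by rwa [hhalf]) (by rwa [hhalf])
  have m4 := main (0 + 1 / 2) (by rw [hhalf]; simp) (by rw [hhalf]; simp; linarith)
  exact ⟨re_pos_aux _ m1, re_pos_aux _ m2, re_div_pos_aux _ _ m3 m1, re_div_pos_aux _ _ m4 m2⟩
end
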